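/- Let n ≥ 1 and let Q₁,…,Qₙ be pairwise distinct smooth conics in ℙ² for which there exists a point p ∈ ℙ² such that Qᵢ ∩ Qⱼ = {p} for all i ≠ j. If n = 1, then the group π₁(ℙ² ∖ (Q₁ ∪ ⋯ ∪ Qₙ)) is abelian; if n ≥ 2, then this group is big. -/

import Mathlib

open MvPolynomial

noncomputable section

/-- The complex projective plane, with the quotient topology. -/
instance : TopologicalSpace (Projectivization ℂ (Fin 3 → ℂ)) :=
  @instTopologicalSpaceQuotient _ (projectivizationSetoid ℂ (Fin 3 → ℂ)) _

abbrev P2 : Type := Projectivization ℂ (Fin 3 → ℂ)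

/-- The gradient of a polynomial in three variables. -/
def gradP (P : MvPolynomial (Fin 3) ℂ) (v : Fin 3 → ℂ) : Fin 3 → ℂ :=
  fun i => eval v (pderiv i P)

/-- The zero locus in `ℙ²` of a (homogeneous) polynomial in three variables. -/
def zeroLocusP2 (P : MvPolynomial (Fin 3) ℂ) : Set P2 :=
  {x | eval x.rep P = 0}

/-- A smooth conic: the zero locus of a homogeneous polynomial of degree 2 whose
gradient vanishes only at the origin. -/
def IsSmoothConic (Q : Set P2) : Prop :=
  ∃ P : MvPolynomial (Fin 3) ℂ, P.IsHomogeneous 2 ∧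
    (∀ v : Fin 3 → ℂ, v ≠ 0 → gradP P v ≠ 0) ∧ Q = zeroLocusP2 P

/-- A group is big if it contains a non-abelian free subgroup. -/
def IsBig (G : Type*) [Group G] : Prop :=
  ∃ H : Subgroup G, Nonempty (H ≃* FreeGroup (Fin 2))

section Holonomy

variable {B G : Type*} [TopologicalSpace B] [Group G] [TopologicalSpace G] [DiscreteTopology G]

/-- The monodromy of a covering map along a path is the endpoint of any lift of the path. -/
theorem IsCoveringMap.monodromy_mk_of_lift {E X : Type*} [TopologicalSpace E] [TopologicalSpace X]
    {p : E → X} (cov : IsCoveringMap p) {x y : X} (γ : Path x y) (Γ : C(unitInterval, E))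
    (hΓ : ∀ t, p (Γ t) = γ t) (e : p ⁻¹' {x}) (h0 : Γ 0 = e) :
    (cov.monodromy (Path.Homotopic.Quotient.mk γ) e : E) = Γ 1 := by
  have h := (cov.eq_liftPath_iff' (γ := γ) (e := (e : E)) (γ_0 := γ.source.trans e.2.symm)
    (Γ := Γ)).mpr ⟨funext hΓ, h0⟩
  rw [h]
  rfl

open Classical in
/-- The principal bundle over `U ∪ V` with discrete structure group, glued along the locally
constant transition function `g` on `U ∩ V`. -/
def gluingCore (U V : Set B) (hU : IsOpen U) (hV : IsOpen V) (hUV : ∀ b, b ∉ U → b ∈ V)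
    (g : B → G) (hg : ContinuousOn g (U ∩ V)) : FiberBundleCore Bool B G where
  baseSet i := if i then U else V
  isOpen_baseSet i := by cases i <;> simpa
  indexAt b := decide (b ∈ U)
  mem_baseSet_at b := by
    by_cases h : b ∈ U <;> simp [h, hUV]
  coordChange i j b v := v * (if i then 1 else g b) * (if j then 1 else g b)⁻¹
  coordChange_self i b _ v := by cases i <;> simp
  continuousOn_coordChange i j := by
    have h1 : ContinuousOn (fun p : B × G => g p.1) ((U ∩ V) ×ˢ Set.univ) :=
      hg.comp continuousOn_fst fun p hp => hp.1
    cases i <;> cases j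
    · simpa using continuousOn_snd
    · simpa [Set.inter_comm] using! continuousOn_snd.mul h1
    · simpa using! continuousOn_snd.mul h1.inv
    · simpa using continuousOn_snd
  coordChange_comp i j k b _ v := by group

variable {U V : Set B} {hU : IsOpen U} {hV : IsOpen V} {hUV : ∀ b, b ∉ U → b ∈ V}
  {g : B → G} {hg : ContinuousOn g (U ∩ V)}

/-- The point of the total space with base point `b` and fibre coordinate `v`. -/
def gluingPoint (U V : Set B) (hU : IsOpen U) (hV : IsOpen V) (hUV : ∀ b, b ∉ U → b ∈ V)
    (g : B → G) (hg : ContinuousOn g (U ∩ V)) (b : B) (v : G) :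
    (gluingCore U V hU hV hUV g hg).TotalSpace := ⟨b, v⟩

/-- The fibre coordinate of a point of the total space. -/
def gluingVal (e : (gluingCore U V hU hV hUV g hg).TotalSpace) : G := e.2

theorem gluingPoint_inj {b : B} {v w : G} :
    gluingPoint U V hU hV hUV g hg b v = gluingPoint U V hU hV hUV g hg b w ↔ v = w :=
  Bundle.TotalSpace.mk_inj

/-- The structure group acts fibrewise by left multiplication. -/
instance gluingCoreAction : MulAction G (gluingCore U V hU hV hUV g hg).TotalSpace where
  smul a e := gluingPoint U V hU hV hUV g hg e.1 (a * gluingVal e)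
  one_smul e := by
    change gluingPoint U V hU hV hUV g hg e.1 (1 * gluingVal e) = e
    rw [one_mul]
    rfl
  mul_smul a b e := by
    change gluingPoint U V hU hV hUV g hg e.1 (a * b * gluingVal e)
      = gluingPoint U V hU hV hUV g hg e.1 (a * (b * gluingVal e))
    rw [mul_assoc]

theorem gluingCore_smul_def (a : G) (e : (gluingCore U V hU hV hUV g hg).TotalSpace) :
    a • e = gluingPoint U V hU hV hUV g hg e.1 (a * gluingVal e) := rfl

theorem gluingCore_isQuotientCoveringMap :
    IsQuotientCoveringMap (gluingCore U V hU hV hUV g hg).proj G := by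
  rw [isQuotientCoveringMap_iff_isCoveringMap_and]
  refine ⟨FiberBundle.isCoveringMap, ?_, ⟨fun a => ?_⟩, ⟨fun {a b} e h => ?_⟩, fun {e₁ e₂} => ?_⟩
  · exact fun b => ⟨gluingPoint U V hU hV hUV g hg b 1, rfl⟩
  · rw [continuous_iff_continuousAt]
    intro e
    rw [FiberBundle.continuousAt_totalSpace]
    refine ⟨(gluingCore U V hU hV hUV g hg).continuous_proj.continuousAt, ?_⟩
    have h := ((FiberBundle.continuousAt_totalSpace G _).1
      (continuousAt_id (x := e))).2
    have h' : ContinuousAt (fun e' : (gluingCore U V hU hV hUV g hg).TotalSpace =>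
        (gluingCore U V hU hV hUV g hg).coordChange ((gluingCore U V hU hV hUV g hg).indexAt e'.1)
          ((gluingCore U V hU hV hUV g hg).indexAt e.1) e'.1 (gluingVal e')) e := h
    refine (continuousAt_const (y := a).mul h').congr (Filter.Eventually.of_forall fun e' => ?_)
    change a * (gluingVal e' * _ * _) = a * gluingVal e' * _ * _
    simp only [mul_assoc]
    rfl
  · have h2 := gluingPoint_inj.1 h
    exact mul_right_cancel h2
  · rcases e₁ with ⟨b₁, v₁⟩
    rcases e₂ with ⟨b₂, v₂⟩
    constructor
    · intro h
      obtain rfl : b₁ = b₂ := h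
      change G at v₁ v₂
      refine ⟨v₁ * v₂⁻¹, ?_⟩
      change gluingPoint U V hU hV hUV g hg b₁ (v₁ * v₂⁻¹ * v₂) =
        gluingPoint U V hU hV hUV g hg b₁ v₁
      rw [inv_mul_cancel_right]
    · rintro ⟨a, ha⟩
      exact (congrArg Bundle.TotalSpace.proj ha).symm

open Classical in
/-- Flat sections over the path `γ` lying in the chart `i`. -/
theorem exists_gluingLift (i : Bool) {x y : B} (γ : Path x y)
    (hγ : ∀ t, γ t ∈ (if i then U else V)) (v : G) :
    ∃ Γ : C(unitInterval, (gluingCore U V hU hV hUV g hg).TotalSpace),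
      ∀ t, Γ t = gluingPoint U V hU hV hUV g hg (γ t)
        (v * (if i then 1 else g (γ t)) * (if γ t ∈ U then 1 else g (γ t))⁻¹) := by
  refine ⟨⟨fun t => ((gluingCore U V hU hV hUV g hg).localTriv
    i).toOpenPartialHomeomorph.symm (γ t, v), ?_⟩, fun t => ?_⟩
  · refine ((gluingCore U V hU hV hUV g hg).localTriv
      i).toOpenPartialHomeomorph.continuousOn_symm.comp_continuous (by fun_prop) fun t => ?_
    exact ((gluingCore U V hU hV hUV g hg).mem_localTriv_target i _).2 (hγ t)
  · change gluingPoint U V hU hV hUV g hg (γ t)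
      (v * (if i then 1 else g (γ t)) * (if decide (γ t ∈ U) then 1 else g (γ t))⁻¹) = _
    simp only [decide_eq_true_eq]

/-- A locally constant transition function on the intersection of two open sets covering a space
defines a holonomy homomorphism on the fundamental group, which on a loop crossing from one set to
the other only once is the value of the transition function at the crossing. -/
theorem exists_holonomy (U V : Set B) (hU : IsOpen U) (hV : IsOpen V) (hUV : ∀ b, b ∉ U → b ∈ V)
    (g : B → G) (hg : ContinuousOn g (U ∩ V)) (x : B) (hx : x ∈ U) (hgx : g x = 1) :
    ∃ φ : FundamentalGroup B x →* Gᵐᵒᵖ, ∀ (y : B) (γ : Path x y) (δ : Path y x),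
      (∀ t, γ t ∈ U) → (∀ t, δ t ∈ V) →
      φ (FundamentalGroup.fromPath (Path.Homotopic.Quotient.mk (γ.trans δ))) =
        MulOpposite.op (g y)⁻¹ := by
  have hq : IsQuotientCoveringMap (gluingCore U V hU hV hUV g hg).proj G :=
    gluingCore_isQuotientCoveringMap
  let e : (gluingCore U V hU hV hUV g hg).proj ⁻¹' {x} := ⟨gluingPoint U V hU hV hUV g hg x 1, rfl⟩
  refine ⟨hq.fundamentalGroupToMulOpposite e, fun y γ δ hγ hδ => ?_⟩
  rw [hq.fundamentalGroupToMulOpposite_apply_eq_Iff]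
  have hyU : y ∈ U := by simpa using hγ 1
  let ey : (gluingCore U V hU hV hUV g hg).proj ⁻¹' {y} :=
    ⟨gluingPoint U V hU hV hUV g hg y 1, rfl⟩
  obtain ⟨Γ, hΓ⟩ := exists_gluingLift (hU := hU) (hV := hV) (hUV := hUV) (hg := hg)
    true γ (fun t => hγ t) 1
  obtain ⟨Δ, hΔ⟩ := exists_gluingLift (hU := hU) (hV := hV) (hUV := hUV) (hg := hg)
    false δ (fun t => hδ t) (g y)⁻¹
  have h1 : hq.isCoveringMap.monodromy (Path.Homotopic.Quotient.mk γ) e = ey := by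
    apply Subtype.ext
    rw [hq.isCoveringMap.monodromy_mk_of_lift γ Γ (fun t => by rw [hΓ]; rfl)]
    · rw [hΓ]
      simp [hyU, ey]
    · rw [hΓ]
      simp [hx, e]
  have h2 : (hq.isCoveringMap.monodromy (Path.Homotopic.Quotient.mk δ) ey).1 =
      gluingPoint U V hU hV hUV g hg x (g y)⁻¹ := by
    rw [hq.isCoveringMap.monodromy_mk_of_lift δ Δ (fun t => by rw [hΔ]; rfl)]
    · rw [hΔ]
      simp [hx, hgx]
    · rw [hΔ]
      simp [hyU, ey]
  change _ = (hq.isCoveringMap.monodromy ((Path.Homotopic.Quotient.mk γ).trans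
    (Path.Homotopic.Quotient.mk δ)) e).1
  rw [hq.isCoveringMap.monodromy_trans_apply, h1, h2, gluingCore_smul_def]
  exact congrArg (gluingPoint U V hU hV hUV g hg x) (mul_one _)

end Holonomy

section Big

theorem IsBig.of_injective {G H : Type*} [Group G] [Group H] (f : G →* H)
    (hf : Function.Injective f) (hG : IsBig G) : IsBig H := by
  obtain ⟨K, ⟨e⟩⟩ := hG
  exact ⟨K.map f, ⟨(K.equivMapOfInjective f hf).symm.trans e⟩⟩

theorem IsBig.of_hom_freeGroup {G : Type*} [Group G] (φ : G →* (FreeGroup (Fin 2))ᵐᵒᵖ)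
    (u : Fin 2 → G) (hu : ∀ i, φ (u i) = MulOpposite.op (FreeGroup.of i)⁻¹) : IsBig G := by
  have h : ((MulEquiv.inv' (FreeGroup (Fin 2))).symm.toMonoidHom.comp φ).comp
      (FreeGroup.lift u) = MonoidHom.id _ := by
    ext i
    simp [hu, MulEquiv.inv']
  have hinj : Function.Injective (FreeGroup.lift u) :=
    Function.LeftInverse.injective (g := (MulEquiv.inv' (FreeGroup (Fin 2))).symm.toMonoidHom.comp φ)
      fun x => DFunLike.congr_fun h x
  exact ⟨(FreeGroup.lift u).range, ⟨(MonoidHom.ofInjective hinj).symm⟩⟩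

theorem IsBig.of_continuous_leftInverse {X Y : Type*} [TopologicalSpace X] [TopologicalSpace Y]
    (f : C(X, Y)) (g : C(Y, X)) (hgf : ∀ x, g (f x) = x) (x : X)
    (hX : IsBig (FundamentalGroup X x)) : IsBig (FundamentalGroup Y (f x)) := by
  refine hX.of_injective (FundamentalGroup.map f x) fun a b hab => ?_
  induction a using Path.Homotopic.Quotient.ind with | _ γ₁ => ?_
  induction b using Path.Homotopic.Quotient.ind with | _ γ₂ => ?_
  have h : (γ₁.map f.continuous).Homotopic (γ₂.map f.continuous) :=
    Path.Homotopic.Quotient.eq.1 hab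
  refine Path.Homotopic.Quotient.eq.2 ?_
  have h2 := ContinuousMap.HomotopicRel.comp_continuousMap h g
  have hc : ∀ γ : Path x x, g.comp (γ.map f.continuous).toContinuousMap = γ.toContinuousMap :=
    fun γ => ContinuousMap.ext fun t => hgf (γ t)
  rwa [hc, hc] at h2

end Big

section PuncturedPlane

/-- The points of the plane lying strictly above (for `σ = 1`) or below (for `σ = -1`) every point
of `S` with the same value of `r`. -/
def sideSet (S : Set ℂ) (r : ℂ →L[ℝ] ℝ) (σ : ℝ) : Set ℂ :=
  {z | ∀ s ∈ S, r z = r s → 0 < σ * (z.im - s.im)}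

variable {S : Set ℂ} {r : ℂ →L[ℝ] ℝ} {σ : ℝ}

theorem sideSet_subset_compl : sideSet S r σ ⊆ Sᶜ := fun z hz hzS => by
  simpa using hz z hzS rfl

theorem isOpen_sideSet (hS : S.Finite) : IsOpen (sideSet S r σ) := by
  have : sideSet S r σ = ⋂ s ∈ S, {z | r z = r s ∧ σ * (z.im - s.im) ≤ 0}ᶜ := by
    ext z
    simp [sideSet]
  rw [this]
  refine hS.isOpen_biInter fun s _ => IsClosed.isOpen_compl (self := ?_)
  exact (isClosed_eq r.continuous continuous_const).inter
    (isClosed_le (f := fun z : ℂ => σ * (z.im - s.im)) (by fun_prop) continuous_const)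

theorem joinedIn_sideSet (hS : S.Finite) (hσ : σ * σ = 1) {d : ℂ} (hrd : r d = 0) (hd : d.im = 1)
    {z w : ℂ} (hz : z ∈ sideSet S r σ) (hw : w ∈ sideSet S r σ) :
    JoinedIn (sideSet S r σ) z w := by
  obtain ⟨M, hM⟩ := (hS.image fun s => σ * s.im).bddAbove
  have hM' : ∀ s ∈ S, σ * s.im ≤ M := fun s hs => hM ⟨s, hs, rfl⟩
  have hup : ∀ z ∈ sideSet S r σ, ∀ c : ℝ, 0 ≤ c →
      JoinedIn (sideSet S r σ) z (z + (c * σ : ℝ) • d) := by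
    intro z hz c hc
    refine JoinedIn.of_segment_subset ?_
    rintro _ ⟨a, b, ha, hb, hab, rfl⟩ s hs h
    have h1 : a • z + b • (z + (c * σ : ℝ) • d) = z + (b * (c * σ)) • d := by
      rw [smul_add, ← add_assoc, ← add_smul, hab, one_smul, smul_smul]
    rw [h1] at h ⊢
    have h2 := hz s hs (by rwa [map_add, map_smul, hrd, smul_zero, add_zero] at h)
    have h3 : (z + (b * (c * σ)) • d).im = z.im + b * (c * σ) := by simp [hd]
    rw [h3]
    have : 0 ≤ b * c := mul_nonneg hb hc
    nlinarith
  have hhigh : ∀ z, M < σ * z.im → z ∈ sideSet S r σ := fun z hz s hs _ => by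
    have := hM' s hs
    linarith
  have hseg : ∀ z w : ℂ, M < σ * z.im → M < σ * w.im → JoinedIn (sideSet S r σ) z w := by
    intro z w hz hw
    refine JoinedIn.of_segment_subset ?_
    rintro _ ⟨a, b, ha, hb, hab, rfl⟩
    apply hhigh
    have h3 : (a • z + b • w).im = a * z.im + b * w.im := by simp
    rw [h3]
    obtain rfl : a = 1 - b := by linarith
    rcases eq_or_lt_of_le hb with rfl | hb
    · simpa using hz
    · nlinarith
  have htop : ∀ z : ℂ, ∃ c : ℝ, 0 ≤ c ∧ M < σ * (z + (c * σ : ℝ) • d).im := by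
    intro z
    refine ⟨|M - σ * z.im| + 1, by positivity, ?_⟩
    have h3 : σ * (z + ((|M - σ * z.im| + 1) * σ : ℝ) • d).im =
        σ * z.im + (|M - σ * z.im| + 1) * (σ * σ) := by simp [hd]; ring
    rw [h3, hσ]
    have := le_abs_self (M - σ * z.im)
    linarith
  obtain ⟨c, hc, hcM⟩ := htop z
  obtain ⟨e, he, heM⟩ := htop w
  exact (hup z hz c hc).trans ((hseg _ _ hcM heM).trans (hup w hw e he).symm)

/-- For all but finitely many directions, a finite subset of the plane projects injectively. -/
theorem exists_injOn_projection (hS : S.Finite) :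
    ∃ (r : ℂ →L[ℝ] ℝ) (d : ℂ), Set.InjOn r S ∧ r d = 0 ∧ d.im = 1 ∧ ∀ c : ℝ, r c = c := by
  obtain ⟨t, ht⟩ := (((hS.prod hS).image
    fun p : ℂ × ℂ => (p.1 - p.2).re / (p.1 - p.2).im)).infinite_compl.nonempty
  refine ⟨Complex.reCLM - t • Complex.imCLM, t + Complex.I, fun z hz w hw h => ?_, by simp,
    by simp, by simp⟩
  have h' : (z - w).re = t * (z - w).im := by
    have : z.re - t * z.im = w.re - t * w.im := by simpa using h
    simp only [Complex.sub_re, Complex.sub_im]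
    linarith
  by_cases him : (z - w).im = 0
  · rw [him, mul_zero] at h'
    exact sub_eq_zero.1 (Complex.ext h' him)
  · exact (ht ⟨(z, w), ⟨hz, hw⟩, by simp only; rw [h', mul_div_cancel_right₀ _ him]⟩).elim

theorem exists_path_of_joinedIn {X : Type*} [TopologicalSpace X] {T F : Set X} (hF : F ⊆ T)
    {x y : T} (h : JoinedIn F (x : X) y) : ∃ γ : Path x y, ∀ t, (γ t : X) ∈ F := by
  obtain ⟨γ, hγ⟩ := h
  refine ⟨⟨⟨fun t => ⟨γ t, hF (hγ t)⟩, by fun_prop⟩, ?_, ?_⟩, hγ⟩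
  · exact Subtype.ext γ.source
  · exact Subtype.ext γ.target

theorem isBig_fundamentalGroup_compl_finite (hS : S.Finite) (hS2 : S.Nontrivial) (w : ↥Sᶜ) :
    IsBig (FundamentalGroup ↥Sᶜ w) := by
  obtain ⟨r, d, hr, hrd, hd, hrc⟩ := exists_injOn_projection hS
  obtain ⟨α, hα, β, hβ, hαβ⟩ : ∃ α ∈ r '' S, ∃ β ∈ r '' S, α < β := by
    obtain ⟨s, hs, s', hs', hss⟩ := hS2
    rcases lt_or_gt_of_ne (fun h => hss (hr hs hs' h)) with h | h
    · exact ⟨_, ⟨s, hs, rfl⟩, _, ⟨s', hs', rfl⟩, h⟩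
    · exact ⟨_, ⟨s', hs', rfl⟩, _, ⟨s, hs, rfl⟩, h⟩
  have hfin : (r '' S).Finite := hS.image r
  obtain ⟨a, ha, haS⟩ := (Set.Iio_infinite α).exists_notMem_finite hfin
  obtain ⟨b, hb, hbS⟩ := (Set.Ioo_infinite hαβ).exists_notMem_finite hfin
  obtain ⟨c, hc, hcS⟩ := (Set.Ioi_infinite β).exists_notMem_finite hfin
  have hside : ∀ a : ℝ, a ∉ r '' S → ∀ σ, (a : ℂ) ∈ sideSet S r σ := fun a ha σ s hs h =>
    (ha ⟨s, hs, by rw [← h, hrc]⟩).elim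
  let _ : TopologicalSpace (FreeGroup (Fin 2)) := ⊥
  have : DiscreteTopology (FreeGroup (Fin 2)) := ⟨rfl⟩
  let U (σ : ℝ) : Set ↥Sᶜ := Subtype.val ⁻¹' sideSet S r σ
  have hU : ∀ σ, IsOpen (U σ) := fun σ => (isOpen_sideSet hS).preimage continuous_subtype_val
  have hUV : ∀ z, z ∉ U 1 → z ∈ U (-1) := by
    intro z hz s hs h
    simp only [U, sideSet, Set.mem_preimage, Set.mem_ofPred_eq, not_forall] at hz
    obtain ⟨s', hs', h', him⟩ := hz
    obtain rfl : s = s' := hr hs hs' (h.symm.trans h')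
    have hne : (z : ℂ).im ≠ s.im := by
      intro him'
      have hz : (z : ℂ) = s + ((z : ℂ).re - s.re : ℝ) := Complex.ext (by simp) (by simp [him'])
      have h0 : r z = r s + ((z : ℂ).re - s.re) := by
        conv_lhs => rw [hz, map_add, hrc]
      have hre : (z : ℂ).re = s.re := by linarith
      exact z.2 (Complex.ext hre him' ▸ hs)
    have := lt_of_le_of_ne (by linarith) hne
    linarith
  let g (z : ↥Sᶜ) : FreeGroup (Fin 2) :=
    if r z < α then 1 else if r z < β then FreeGroup.of 0 else FreeGroup.of 1
  have hg : ContinuousOn g (U 1 ∩ U (-1)) := by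
    rintro z ⟨hz1, hz2⟩
    have hzr : ∀ τ ∈ r '' S, r z ≠ τ := by
      rintro _ ⟨s, hs, rfl⟩ h
      have h1 := hz1 s hs h
      have h2 := hz2 s hs h
      linarith
    have hrz : Continuous fun z : ↥Sᶜ => r z := by fun_prop
    have hev : ∀ τ ∈ r '' S, ∀ᶠ z' : ↥Sᶜ in nhds z, (r z' < τ ↔ r z < τ) := by
      intro τ hτ
      rcases lt_or_gt_of_ne (hzr τ hτ) with h | h
      · filter_upwards [hrz.continuousAt.eventually_lt_const h] with z' hz'
        simp [hz', h]
      · filter_upwards [hrz.continuousAt.eventually_const_lt h] with z' hz'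
        simp [hz'.not_gt, h.not_gt]
    refine ContinuousAt.continuousWithinAt (continuousAt_const (y := g z) |>.congr ?_)
    filter_upwards [hev α hα, hev β hβ] with z' h1 h2
    simp only [g, h1, h2]
  let x₀ : ↥Sᶜ := ⟨a, sideSet_subset_compl (hside a haS 1)⟩
  obtain ⟨φ, hφ⟩ := exists_holonomy (U 1) (U (-1)) (hU 1) (hU (-1)) hUV g hg x₀ (hside a haS 1)
    (by simpa [g, x₀, hrc] using fun h => absurd ha (not_lt.2 h))
  have hloop : ∀ (y : ℝ), y ∉ r '' S → ∀ k : Fin 2,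
      (if y < α then 1 else if y < β then FreeGroup.of 0 else FreeGroup.of 1) = FreeGroup.of k →
      ∃ u : FundamentalGroup ↥Sᶜ x₀, φ u = MulOpposite.op (FreeGroup.of k)⁻¹ := by
    intro y hy k hk
    let y' : ↥Sᶜ := ⟨y, sideSet_subset_compl (hside y hy 1)⟩
    obtain ⟨γ, hγ⟩ := exists_path_of_joinedIn (sideSet_subset_compl) (x := x₀) (y := y')
      (joinedIn_sideSet hS (σ := 1) (by norm_num) hrd hd (hside a haS 1) (hside y hy 1))
    obtain ⟨δ, hδ⟩ := exists_path_of_joinedIn (sideSet_subset_compl) (x := y') (y := x₀)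
      (joinedIn_sideSet hS (σ := -1) (by norm_num) hrd hd (hside y hy (-1)) (hside a haS (-1)))
    refine ⟨_, (hφ y' γ δ hγ hδ).trans ?_⟩
    rw [← hk]
    simp only [g, y', hrc]
  obtain ⟨u, hu⟩ := hloop b hbS 0 (by simp [hb.1.not_gt, hb.2])
  obtain ⟨v, hv⟩ := hloop c hcS 1 (by
    simp [(show β < c from hc).not_gt, (hαβ.trans (show β < c from hc)).not_gt])
  have hbig : IsBig (FundamentalGroup ↥Sᶜ x₀) :=
    IsBig.of_hom_freeGroup φ ![u, v] (Fin.forall_fin_two.2 ⟨hu, hv⟩)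
  have hpc : IsPathConnected Sᶜ := hS.countable.isPathConnected_compl_of_one_lt_rank (by
    rw [Complex.rank_real_complex]; norm_num)
  have := isPathConnected_iff_pathConnectedSpace.1 hpc
  let e := FundamentalGroup.fundamentalGroupMulEquivOfPathConnected x₀ w
  exact hbig.of_injective e.toMonoidHom e.injective

end PuncturedPlane

section NormalForm

theorem pderiv_pderiv_comm {R τ : Type*} [CommRing R] (i j : τ) (P : MvPolynomial τ R) :
    pderiv i (pderiv j P) = pderiv j (pderiv i P) := by
  classical
  have h : ⁅(pderiv i : Derivation R (MvPolynomial τ R) (MvPolynomial τ R)),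
      (pderiv j : Derivation R (MvPolynomial τ R) (MvPolynomial τ R))⁆ = 0 := by
    refine MvPolynomial.derivation_ext fun k => ?_
    simp [Derivation.commutator_apply, pderiv_X, Pi.single_apply, apply_ite]
  have h2 := DFunLike.congr_fun h P
  rwa [Derivation.commutator_apply, Derivation.coe_zero, Pi.zero_apply, sub_eq_zero] at h2

theorem MvPolynomial.IsHomogeneous.eval_eq_eval_zero {P : MvPolynomial (Fin 3) ℂ}
    (hP : P.IsHomogeneous 0) (v : Fin 3 → ℂ) : eval v P = eval 0 P := by
  rw [← totalDegree_zero_iff_isHomogeneous, totalDegree_eq_zero_iff_eq_C] at hP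
  rw [hP, eval_C, eval_C]

/-- A smooth conic is the zero locus of a nondegenerate symmetric bilinear form. -/
theorem IsSmoothConic.exists_bilinForm {Q : Set P2} (hQ : IsSmoothConic Q) :
    ∃ B : LinearMap.BilinForm ℂ (Fin 3 → ℂ), (∀ v w, B v w = B w v) ∧
      (∀ w, (∀ v, B v w = 0) → w = 0) ∧
      ∀ (v : Fin 3 → ℂ) (hv : v ≠ 0), Projectivization.mk ℂ v hv ∈ Q ↔ B v v = 0 := by
  obtain ⟨P, hP, hgrad, rfl⟩ := hQ
  let M : Matrix (Fin 3) (Fin 3) ℂ := Matrix.of fun i j => eval 0 (pderiv j (pderiv i P))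
  have hB : ∀ v w, Matrix.toBilin' M v w = ∑ i, v i * gradP P w i := by
    intro v w
    rw [Matrix.toBilin'_apply]
    refine Finset.sum_congr rfl fun i _ => ?_
    have h := congrArg (eval w) (hP.pderiv (i := i)).sum_X_mul_pderiv
    have h0 : ∀ j, eval w (pderiv j (pderiv i P)) = M i j := fun j =>
      (hP.pderiv (i := i)).pderiv.eval_eq_eval_zero w
    simp only [map_sum, map_mul, eval_X, h0] at h
    rw [gradP]
    simp only [Nat.add_one_sub_one, one_smul] at h
    rw [← h, Finset.mul_sum]
    exact Finset.sum_congr rfl fun j _ => by ring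
  have hBP : ∀ v, Matrix.toBilin' M v v = 2 * eval v P := by
    intro v
    have h := congrArg (eval v) hP.sum_X_mul_pderiv
    simp only [map_sum, map_mul, eval_X, nsmul_eq_mul, Nat.cast_ofNat] at h
    rw [hB]
    simpa [gradP] using h
  refine ⟨Matrix.toBilin' M, fun v w => ?_, fun w hw => ?_, fun v hv => ?_⟩
  · rw [Matrix.toBilin'_apply, Matrix.toBilin'_apply, Finset.sum_comm]
    refine Finset.sum_congr rfl fun i _ => Finset.sum_congr rfl fun j _ => ?_
    have : M j i = M i j := by simp [M, pderiv_pderiv_comm i j]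
    rw [this]
    ring
  · by_contra hne
    refine hgrad w hne (funext fun i => ?_)
    have h := hw (Pi.single i 1)
    rw [hB] at h
    simpa [Pi.single_apply] using h
  · obtain ⟨a, ha⟩ := Projectivization.exists_smul_eq_mk_rep ℂ v hv
    change eval (Projectivization.mk ℂ v hv).rep P = 0 ↔ _
    have h : 2 * eval (Projectivization.mk ℂ v hv).rep P =
        (a : ℂ) * (a * Matrix.toBilin' M v v) := by
      rw [← hBP, ← ha, Units.smul_def, map_smul, map_smul, LinearMap.smul_apply, smul_eq_mul,
        smul_eq_mul]
    constructor
    · intro h0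
      rw [h0, mul_zero] at h
      simpa using h.symm
    · intro h0
      rw [h0] at h
      simpa using h

variable {B : LinearMap.BilinForm ℂ (Fin 3 → ℂ)}

theorem exists_isotropic (B : LinearMap.BilinForm ℂ (Fin 3 → ℂ)) (hs : ∀ v w, B v w = B w v) :
    ∃ v, v ≠ 0 ∧ B v v = 0 := by
  by_cases h : B (Pi.single 1 1) (Pi.single 1 1) = 0
  · exact ⟨_, by simp, h⟩
  · obtain ⟨t, ht⟩ := exists_quadratic_eq_zero (a := B (Pi.single 1 1) (Pi.single 1 1))
      (b := 2 * B (Pi.single 0 1) (Pi.single 1 1)) (c := B (Pi.single 0 1) (Pi.single 0 1)) h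
      (IsAlgClosed.exists_eq_mul_self _)
    refine ⟨Pi.single 0 1 + t • Pi.single 1 1, fun h0 => ?_, ?_⟩
    · simpa using congrFun h0 0
    · simp only [map_add, map_smul, LinearMap.add_apply, LinearMap.smul_apply, smul_eq_mul,
        hs (Pi.single 1 1) (Pi.single 0 1)]
      linear_combination ht

/-- The quadratic form `x² + yz`. -/
def stdQuad (v : Fin 3 → ℂ) : ℂ := v 0 ^ 2 + v 1 * v 2

theorem exists_linearEquiv_stdQuad (hs : ∀ v w, B v w = B w v)
    (hnd : ∀ w, (∀ v, B v w = 0) → w = 0) {p : Fin 3 → ℂ} (hp : p ≠ 0) (hpp : B p p = 0) :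
    ∃ L : (Fin 3 → ℂ) ≃ₗ[ℂ] (Fin 3 → ℂ), L (Pi.single 1 1) = p ∧
      ∀ v, B (L v) (L v) = stdQuad v := by
  obtain ⟨u, hu⟩ : ∃ u, B u p ≠ 0 := by
    by_contra! h
    exact hp (hnd p h)
  obtain ⟨q, hq, hqq⟩ : ∃ q, B p q = 1 / 2 ∧ B q q = 0 := by
    refine ⟨(1 / (2 * B u p)) • u + (-((1 / (2 * B u p)) ^ 2 * B u u)) • p, ?_, ?_⟩
    · simp only [map_add, map_smul, smul_eq_mul, hpp, hs p u]
      field_simp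
      ring
    · simp only [map_add, map_smul, LinearMap.add_apply, LinearMap.smul_apply, smul_eq_mul, hpp,
        hs p u]
      field_simp
      ring
  obtain ⟨f, hf0, hfp, hfq⟩ : ∃ f, f ≠ 0 ∧ B f p = 0 ∧ B f q = 0 := by
    have hlt : Module.finrank ℂ (ℂ × ℂ) < Module.finrank ℂ (Fin 3 → ℂ) := by simp
    obtain ⟨f, hf, hf0⟩ := Submodule.exists_mem_ne_zero_of_ne_bot
      (LinearMap.ker_ne_bot_of_finrank_lt (f := (B p).prod (B q)) hlt)
    rw [LinearMap.mem_ker, LinearMap.prod_apply, Function.prod_apply, Prod.mk_eq_zero] at hf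
    exact ⟨f, hf0, by rw [hs]; exact hf.1, by rw [hs]; exact hf.2⟩
  have hpq : B q p = 1 / 2 := by rw [hs, hq]
  have hli : ∀ f, f ≠ 0 → B f p = 0 → B f q = 0 → LinearIndependent ℂ ![f, p, q] := by
    intro f hf0 hfp hfq
    rw [Fintype.linearIndependent_iff]
    intro c hc
    rw [Fin.sum_univ_three] at hc
    simp only [Matrix.cons_val_zero, Matrix.cons_val_one, Matrix.cons_val] at hc
    have h1 := congrArg (fun v => B v p) hc
    have h2 := congrArg (fun v => B v q) hc
    simp only [map_add, map_smul, LinearMap.add_apply, LinearMap.smul_apply, smul_eq_mul, hpp,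
      hfp, hpq, hfq, hq, hqq, map_zero, LinearMap.zero_apply] at h1 h2
    have h1' : c 2 = 0 := by linear_combination 2 * h1
    have h2' : c 1 = 0 := by linear_combination 2 * h2
    rw [h1', h2'] at hc
    have h0 : c 0 = 0 := by simpa [hf0] using hc
    exact Fin.forall_fin_succ.2 ⟨h0, Fin.forall_fin_two.2 ⟨h2', h1'⟩⟩
  have hcard : Fintype.card (Fin 3) = Module.finrank ℂ (Fin 3 → ℂ) := by simp
  have hff : B f f ≠ 0 := by
    intro hff
    refine hf0 (hnd f fun v => ?_)
    let b := basisOfLinearIndependentOfCardEqFinrank (hli f hf0 hfp hfq) hcard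
    rw [← b.sum_repr v, Fin.sum_univ_three]
    simp only [b, coe_basisOfLinearIndependentOfCardEqFinrank, Matrix.cons_val_zero,
      Matrix.cons_val_one, Matrix.cons_val, map_add, map_smul, LinearMap.add_apply,
      LinearMap.smul_apply, smul_eq_mul, hff, hs p f, hs q f, hfp, hfq]
    ring
  obtain ⟨t, ht⟩ := IsAlgClosed.exists_eq_mul_self (B f f)
  have ht0 : t ≠ 0 := fun h => hff (by rw [ht, h, mul_zero])
  let b := basisOfLinearIndependentOfCardEqFinrank (hli (t⁻¹ • f) (smul_ne_zero (inv_ne_zero ht0)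
    hf0) (by simp [hfp]) (by simp [hfq])) hcard
  refine ⟨b.equivFun.symm, ?_, fun v => ?_⟩
  · simp [b]
  · rw [Module.Basis.equivFun_symm_apply, Fin.sum_univ_three]
    simp only [b, coe_basisOfLinearIndependentOfCardEqFinrank, Matrix.cons_val_zero,
      Matrix.cons_val_one, Matrix.cons_val, map_add, map_smul, LinearMap.add_apply,
      LinearMap.smul_apply, smul_eq_mul, ht, hs p f, hs q f, hfp, hfq, hpp, hqq, hpq, hq,
      stdQuad]
    field_simp
    ring

/-- A nondegenerate form without zeros on the affine conic `(s, -s², 1)`. -/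
theorem eq_stdQuad_add_of_forall_ne_zero (hs : ∀ v w, B v w = B w v)
    (hnd : ∀ w, (∀ v, B v w = 0) → w = 0) (h : ∀ s : ℂ, B ![s, -s ^ 2, 1] ![s, -s ^ 2, 1] ≠ 0) :
    ∃ A k : ℂ, A ≠ 0 ∧ k ≠ 0 ∧ ∀ v, B v v = A * stdQuad v + k * v 2 ^ 2 := by
  have hexp : ∀ v : Fin 3 → ℂ, v = v 0 • Pi.single 0 1 + v 1 • Pi.single 1 1 +
      v 2 • Pi.single 2 1 := by
    intro v
    ext i
    fin_cases i <;> simp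
  have hB : ∀ v, B v v = v 0 ^ 2 * B (Pi.single 0 1) (Pi.single 0 1) +
      v 1 ^ 2 * B (Pi.single 1 1) (Pi.single 1 1) + v 2 ^ 2 * B (Pi.single 2 1) (Pi.single 2 1) +
      2 * v 0 * v 1 * B (Pi.single 0 1) (Pi.single 1 1) +
      2 * v 0 * v 2 * B (Pi.single 0 1) (Pi.single 2 1) +
      2 * v 1 * v 2 * B (Pi.single 1 1) (Pi.single 2 1) := by
    intro v
    conv_lhs => rw [hexp v]
    simp only [map_add, map_smul, LinearMap.add_apply, LinearMap.smul_apply, smul_eq_mul,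
      hs (Pi.single 1 1) (Pi.single 0 1), hs (Pi.single 2 1) (Pi.single 0 1),
      hs (Pi.single 2 1) (Pi.single 1 1)]
    ring
  set b00 := B (Pi.single 0 1) (Pi.single 0 1)
  set b11 := B (Pi.single 1 1) (Pi.single 1 1)
  set b22 := B (Pi.single 2 1) (Pi.single 2 1)
  set b01 := B (Pi.single 0 1) (Pi.single 1 1) with hb01
  set b02 := B (Pi.single 0 1) (Pi.single 2 1)
  set b12 := B (Pi.single 1 1) (Pi.single 2 1) with hb12
  let f : Polynomial ℂ := Polynomial.C b11 * Polynomial.X ^ 4 +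
    Polynomial.C (-2 * b01) * Polynomial.X ^ 3 + Polynomial.C (b00 - 2 * b12) * Polynomial.X ^ 2 +
    Polynomial.C (2 * b02) * Polynomial.X + Polynomial.C b22
  have hf : ∀ s, f.eval s ≠ 0 := by
    intro s hs0
    apply h s
    rw [hB]
    simp only [f, Polynomial.eval_add, Polynomial.eval_mul, Polynomial.eval_C,
      Polynomial.eval_pow, Polynomial.eval_X] at hs0
    simp only [Matrix.cons_val_zero, Matrix.cons_val_one, Matrix.cons_val]
    linear_combination hs0
  have hdeg : f.degree ≤ 0 := by
    by_contra hlt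
    obtain ⟨z, hz⟩ := Complex.exists_root (not_le.1 hlt)
    exact hf z hz
  have hcoeff : ∀ m, 0 < m → f.coeff m = 0 := fun m hm =>
    Polynomial.coeff_eq_zero_of_degree_lt (hdeg.trans_lt (by exact_mod_cast hm))
  have h1 := hcoeff 1 (by norm_num)
  have h2 := hcoeff 2 (by norm_num)
  have h3 := hcoeff 3 (by norm_num)
  have h4 := hcoeff 4 (by norm_num)
  have h0 := hf 0
  simp only [f, Polynomial.coeff_add, Polynomial.coeff_C_mul, Polynomial.coeff_X_pow,
    Polynomial.coeff_X, Polynomial.coeff_C] at h1 h2 h3 h4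
  norm_num [f] at h0 h1 h2 h3 h4
  refine ⟨b00, b22, fun hA => ?_, h0, fun v => ?_⟩
  · have hrad := hnd (Pi.single 1 1) fun v => by
      rw [hexp v]
      simp only [map_add, map_smul, LinearMap.add_apply, LinearMap.smul_apply, smul_eq_mul]
      rw [hs (Pi.single 2 1)]
      simp only [← hb01, ← hb12, h3]
      change _ + _ * b11 + _ = 0
      rw [hA, zero_sub] at h2
      rw [h4]
      linear_combination (-v 2 / 2) * h2
    simpa using congrFun hrad 1
  · rw [hB, stdQuad, h4, h3, h1]
    linear_combination (-v 1 * v 2) * h2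

end NormalForm

section ArrangementNormalForm

theorem exists_arrangement_normalForm {n : ℕ} (hn : 1 ≤ n) (Q : Fin n → Set P2)
    (hconic : ∀ i, IsSmoothConic (Q i)) (p : P2)
    (hint : ∀ i j : Fin n, i ≠ j → Q i ∩ Q j = {p}) :
    ∃ (L : (Fin 3 → ℂ) ≃ₗ[ℂ] (Fin 3 → ℂ)) (i₀ : Fin n) (c : Fin n → ℂ), c i₀ = 0 ∧
      (∀ i, i ≠ i₀ → c i ≠ 0) ∧ ∀ i (v : Fin 3 → ℂ) (hv : L v ≠ 0),
        Projectivization.mk ℂ (L v) hv ∈ Q i ↔ stdQuad v + c i * v 2 ^ 2 = 0 := by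
  choose B hs hnd hmem using fun i => (hconic i).exists_bilinForm
  let i₀ : Fin n := ⟨0, hn⟩
  obtain ⟨p₀, hp₀, hpp, hp⟩ : ∃ (p₀ : Fin 3 → ℂ) (hp₀ : p₀ ≠ 0), B i₀ p₀ p₀ = 0 ∧
      ∀ i, i ≠ i₀ → Q i ∩ Q i₀ = {Projectivization.mk ℂ p₀ hp₀} := by
    by_cases h : ∃ i, i ≠ i₀
    · obtain ⟨i, hi⟩ := h
      refine ⟨p.rep, p.rep_nonzero, ?_, fun i hi => by rw [p.mk_rep]; exact hint i i₀ hi⟩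
      rw [← hmem i₀ p.rep p.rep_nonzero, p.mk_rep]
      have hpi : p ∈ Q i ∩ Q i₀ := by rw [hint i i₀ hi]; rfl
      exact hpi.2
    · obtain ⟨v, hv, hvv⟩ := exists_isotropic (B i₀) (hs i₀)
      exact ⟨v, hv, hvv, fun i hi => (h ⟨i, hi⟩).elim⟩
  obtain ⟨L, hLp, hL⟩ := exists_linearEquiv_stdQuad (hs i₀) (hnd i₀) hp₀ hpp
  have key : ∀ i, ∃ c : ℂ, (i = i₀ → c = 0) ∧ (i ≠ i₀ → c ≠ 0) ∧ ∀ v (hv : L v ≠ 0),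
      Projectivization.mk ℂ (L v) hv ∈ Q i ↔ stdQuad v + c * v 2 ^ 2 = 0 := by
    intro i
    by_cases hi : i = i₀
    · subst hi
      refine ⟨0, fun _ => rfl, fun h => (h rfl).elim, fun v hv => ?_⟩
      rw [hmem, hL, zero_mul, add_zero]
    · obtain ⟨A, k, hA, hk, h⟩ := eq_stdQuad_add_of_forall_ne_zero
        (B := (B i).comp L.toLinearMap L.toLinearMap)
        (fun v w => hs i (L v) (L w))
        (fun w hw => L.map_eq_zero_iff.1 (hnd i (L w) fun v => by
          have := hw (L.symm v)
          simpa using this))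
        (fun s h0 => by
          have hne : L ![s, -s ^ 2, 1] ≠ 0 := fun h0 => by
            simpa using congrFun (L.map_eq_zero_iff.1 h0) 2
          have h1 : Projectivization.mk ℂ _ hne ∈ Q i ∩ Q i₀ := by
            refine ⟨(hmem i _ hne).2 h0, (hmem i₀ _ hne).2 ?_⟩
            rw [hL]
            simp [stdQuad]
          rw [hp i hi, Set.mem_singleton_iff, Projectivization.mk_eq_mk_iff'] at h1
          obtain ⟨a, ha⟩ := h1
          rw [← hLp, ← map_smul] at ha
          simpa using congrFun (L.injective ha) 2)
      refine ⟨k / A, fun h => (hi h).elim, fun _ => div_ne_zero hk hA, fun v hv => ?_⟩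
      have h2 : B i (L v) (L v) = A * (stdQuad v + k / A * v 2 ^ 2) := by
        rw [mul_add, ← mul_assoc, mul_div_cancel₀ _ hA]
        exact h v
      rw [hmem, h2, mul_eq_zero, or_iff_right hA]
  choose c hc using key
  exact ⟨L, i₀, c, (hc i₀).1 rfl, fun i hi => (hc i).2.1 hi, fun i v hv => (hc i).2.2 v hv⟩

end ArrangementNormalForm

section DoubleCover

theorem isQuotientMap_projectivization_mk :
    Topology.IsQuotientMap (Projectivization.mk' ℂ : {v : Fin 3 → ℂ // v ≠ 0} → P2) :=
  isQuotientMap_quot_mk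

/-- The affine quadric `x² + yz = 1` with the curves `1 + cᵢ z² = 0` removed. -/
def coverSet {n : ℕ} (c : Fin n → ℂ) : Set (Fin 3 → ℂ) :=
  {v | stdQuad v = 1 ∧ ∀ i, 1 + c i * v 2 ^ 2 ≠ 0}

theorem stdQuad_smul (a : ℂ) (v : Fin 3 → ℂ) : stdQuad (a • v) = a ^ 2 * stdQuad v := by
  simp only [stdQuad, Pi.smul_apply, smul_eq_mul]
  ring

theorem continuous_stdQuad : Continuous stdQuad := by
  unfold stdQuad
  fun_prop

variable {n : ℕ} {c : Fin n → ℂ}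

theorem ne_zero_of_mem_coverSet {v : Fin 3 → ℂ} (hv : v ∈ coverSet c) : v ≠ 0 := by
  rintro rfl
  simpa [stdQuad] using hv.1

theorem units_smul_mem_coverSet (u : ℤˣ) {v : Fin 3 → ℂ} (hv : v ∈ coverSet c) :
    u • v ∈ coverSet c := by
  rcases Int.units_eq_one_or u with rfl | rfl
  · rwa [one_smul]
  · rw [Units.neg_smul, one_smul]
    refine ⟨?_, fun i => ?_⟩
    · rw [← hv.1, stdQuad, stdQuad, Pi.neg_apply, Pi.neg_apply, Pi.neg_apply]
      ring
    · rw [Pi.neg_apply, neg_sq]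
      exact hv.2 i

instance coverSetMulAction : MulAction ℤˣ (coverSet c) where
  smul u v := ⟨u • v.1, units_smul_mem_coverSet u v.2⟩
  one_smul _ := Subtype.ext (one_smul _ _)
  mul_smul a b v := Subtype.ext (mul_smul a b v.1)

theorem coe_units_smul_coverSet (u : ℤˣ) (v : coverSet c) : ((u • v : coverSet c) : Fin 3 → ℂ) =
    u • (v : Fin 3 → ℂ) := rfl

variable {Q : Fin n → Set P2} {L : (Fin 3 → ℂ) ≃ₗ[ℂ] (Fin 3 → ℂ)}

/-- The map from the affine double cover to the complement of the conics. -/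
def coverMap (hQ : ∀ i (v : Fin 3 → ℂ) (hv : L v ≠ 0),
      Projectivization.mk ℂ (L v) hv ∈ Q i ↔ stdQuad v + c i * v 2 ^ 2 = 0)
    (v : coverSet c) : ↥(⋃ i, Q i)ᶜ :=
  ⟨Projectivization.mk ℂ (L v) (L.map_ne_zero_iff.2 (ne_zero_of_mem_coverSet v.2)), by
    simp only [Set.mem_compl_iff, Set.mem_iUnion, not_exists, hQ, v.2.1]
    exact v.2.2⟩

theorem coverMap_surjective (hQ : ∀ i (v : Fin 3 → ℂ) (hv : L v ≠ 0),
      Projectivization.mk ℂ (L v) hv ∈ Q i ↔ stdQuad v + c i * v 2 ^ 2 = 0)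
    (hc : ∃ i, c i = 0) : Function.Surjective (coverMap hQ) := by
  rintro ⟨x, hx⟩
  induction x using Projectivization.ind with | _ u hu
  have hLu : L (L.symm u) = u := L.apply_symm_apply u
  have hx' : ∀ i, stdQuad (L.symm u) + c i * L.symm u 2 ^ 2 ≠ 0 := by
    intro i h
    refine hx (Set.mem_iUnion.2 ⟨i, ?_⟩)
    have h2 := (hQ i (L.symm u) (by rwa [hLu])).2 h
    simpa only [hLu] using h2
  obtain ⟨i₀, hi₀⟩ := hc
  have h0 : stdQuad (L.symm u) ≠ 0 := by
    have := hx' i₀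
    rwa [hi₀, zero_mul, add_zero] at this
  obtain ⟨t, ht⟩ := IsAlgClosed.exists_eq_mul_self (stdQuad (L.symm u))
  have ht0 : t ≠ 0 := fun h => h0 (by rw [ht, h, mul_zero])
  refine ⟨⟨t⁻¹ • L.symm u, ?_, fun i h => hx' i ?_⟩, Subtype.ext ?_⟩
  · rw [stdQuad_smul, ht]
    field_simp
  · rw [Pi.smul_apply, smul_eq_mul] at h
    field_simp at h
    linear_combination h + ht
  · refine (Projectivization.mk_eq_mk_iff' ℂ _ _ _ _).2 ⟨t⁻¹, ?_⟩
    simp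

theorem continuous_coverMap (hQ : ∀ i (v : Fin 3 → ℂ) (hv : L v ≠ 0),
      Projectivization.mk ℂ (L v) hv ∈ Q i ↔ stdQuad v + c i * v 2 ^ 2 = 0) :
    Continuous (coverMap hQ) := by
  have hL : Continuous L := L.toLinearMap.continuous_of_finiteDimensional
  refine Continuous.subtype_mk (isQuotientMap_projectivization_mk.continuous.comp
    (f := fun v : coverSet c => ⟨L v, L.map_ne_zero_iff.2 (ne_zero_of_mem_coverSet v.2)⟩) ?_) _
  exact (hL.comp continuous_subtype_val).subtype_mk _

theorem isOpenMap_coverMap (hQ : ∀ i (v : Fin 3 → ℂ) (hv : L v ≠ 0),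
      Projectivization.mk ℂ (L v) hv ∈ Q i ↔ stdQuad v + c i * v 2 ^ 2 = 0) :
    IsOpenMap (coverMap hQ) := by
  have hL : Continuous L.symm := L.symm.toLinearMap.continuous_of_finiteDimensional
  intro W hW
  suffices h : IsOpen (Subtype.val '' (coverMap hQ '' W)) by
    rw [← Set.preimage_image_eq (coverMap hQ '' W) Subtype.val_injective]
    exact h.preimage continuous_subtype_val
  rw [← isQuotientMap_projectivization_mk.isOpen_preimage, isOpen_iff_mem_nhds]
  rintro ⟨u₀, hu₀⟩ ⟨_, ⟨v₀, hv₀, rfl⟩, hu⟩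
  obtain ⟨W, hW', rfl⟩ := isOpen_induced_iff.1 hW
  obtain ⟨a, ha⟩ := (Projectivization.mk_eq_mk_iff' ℂ _ _ _ _).1 hu.symm
  have ha0 : a ≠ 0 := by
    rintro rfl
    exact hu₀ (by rw [← ha, zero_smul])
  let t (u : {v : Fin 3 → ℂ // v ≠ 0}) : ℂ := a * (stdQuad (L.symm u) / a ^ 2) ^ (1 / 2 : ℂ)
  have hst : ∀ u : {v : Fin 3 → ℂ // v ≠ 0}, stdQuad (L.symm u) = t u ^ 2 := by
    intro u
    have : ((stdQuad (L.symm u) / a ^ 2) ^ (1 / 2 : ℂ)) ^ 2 = stdQuad (L.symm u) / a ^ 2 := by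
      rw [one_div]
      exact Complex.cpow_nat_inv_pow _ two_ne_zero
    simp only [t, mul_pow, this]
    field_simp
  have hs0 : L.symm u₀ = a • v₀ := by rw [← ha, map_smul, L.symm_apply_apply]
  have ht0 : t ⟨u₀, hu₀⟩ = a := by
    simp [t, hs0, stdQuad_smul, v₀.2.1, ha0]
  have htc : ContinuousAt t ⟨u₀, hu₀⟩ := by
    refine continuousAt_const.mul (ContinuousAt.cpow ?_ continuousAt_const ?_)
    · have := continuous_stdQuad
      fun_prop
    · simp [hs0, stdQuad_smul, v₀.2.1, ha0]
  let v' (u : {v : Fin 3 → ℂ // v ≠ 0}) : Fin 3 → ℂ := (t u)⁻¹ • L.symm u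
  have hv'0 : v' ⟨u₀, hu₀⟩ = v₀ := by
    simp [v', ht0, hs0, ha0]
  have hv'c : ContinuousAt v' ⟨u₀, hu₀⟩ :=
    (htc.inv₀ (by rwa [ht0])).smul (by fun_prop)
  have hopen : IsOpen (W ∩ {v : Fin 3 → ℂ | ∀ i, 1 + c i * v 2 ^ 2 ≠ 0}) := by
    refine hW'.inter ?_
    simp only [Set.ofPred_forall]
    exact isOpen_iInter_of_finite fun i => isOpen_ne_fun (by fun_prop) (by fun_prop)
  have hev := hv'c.eventually_mem (hopen.mem_nhds (by rw [hv'0]; exact ⟨hv₀, v₀.2.2⟩))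
  filter_upwards [hev, htc.eventually_ne (by rwa [ht0] : t ⟨u₀, hu₀⟩ ≠ 0)] with u h1 h2
  have hmem : v' u ∈ coverSet c := ⟨by
    simp only [v', stdQuad_smul, hst]
    field_simp, h1.2⟩
  refine ⟨_, ⟨⟨v' u, hmem⟩, h1.1, rfl⟩, ?_⟩
  refine (Projectivization.mk_eq_mk_iff' ℂ _ _ _ _).2 ⟨(t u)⁻¹, ?_⟩
  simp [v']

theorem coverMap_isQuotientCoveringMap (hQ : ∀ i (v : Fin 3 → ℂ) (hv : L v ≠ 0),
      Projectivization.mk ℂ (L v) hv ∈ Q i ↔ stdQuad v + c i * v 2 ^ 2 = 0)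
    (hc : ∃ i, c i = 0) : IsQuotientCoveringMap (coverMap hQ) ℤˣ where
  toIsQuotientMap := (isOpenMap_coverMap hQ).isQuotientMap (continuous_coverMap hQ)
    (coverMap_surjective hQ hc)
  continuous_const_smul u := by
    refine Continuous.subtype_mk ?_ _
    have : Continuous fun v : coverSet c => (v : Fin 3 → ℂ) := continuous_subtype_val
    exact this.const_smul (u : ℤ)
  apply_eq_iff_mem_orbit {v w} := by
    rw [Subtype.ext_iff]
    change Projectivization.mk ℂ (L v) _ = Projectivization.mk ℂ (L w) _ ↔ _
    rw [Projectivization.mk_eq_mk_iff']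
    constructor
    · rintro ⟨a, ha⟩
      rw [← map_smul, L.injective.eq_iff] at ha
      have h := v.2.1
      rw [← ha, stdQuad_smul, w.2.1, mul_one, ← one_pow 2, sq_eq_sq_iff_eq_or_eq_neg] at h
      rcases h with rfl | rfl
      · exact ⟨1, Subtype.ext (by rw [← ha]; simp)⟩
      · exact ⟨-1, Subtype.ext (by rw [← ha]; simp [coe_units_smul_coverSet])⟩
    · rintro ⟨u, rfl⟩
      rcases Int.units_eq_one_or u with rfl | rfl
      · exact ⟨1, by simp⟩
      · exact ⟨-1, by simp [coe_units_smul_coverSet]⟩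
  disjoint v := by
    obtain ⟨i, hi⟩ : ∃ i, (v : Fin 3 → ℂ) i ≠ 0 := Function.ne_iff.1 (ne_zero_of_mem_coverSet v.2)
    refine ⟨{w | ‖(w : Fin 3 → ℂ) i - (v : Fin 3 → ℂ) i‖ < ‖(v : Fin 3 → ℂ) i‖}, ?_, fun u => ?_⟩
    · have hci : Continuous fun w : coverSet c => (w : Fin 3 → ℂ) i :=
        (continuous_apply i).comp continuous_subtype_val
      refine (isOpen_lt (hci.sub continuous_const).norm continuous_const).mem_nhds ?_
      simpa using hi
    · rintro ⟨_, ⟨w, hw, rfl⟩, hw'⟩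
      rcases Int.units_eq_one_or u with rfl | rfl
      · rfl
      · exfalso
        simp only [Set.mem_ofPred_eq, coe_units_smul_coverSet, Units.neg_smul, one_smul,
          Pi.neg_apply] at hw hw'
        have h := norm_add_le ((w : Fin 3 → ℂ) i - (v : Fin 3 → ℂ) i)
          (-(w : Fin 3 → ℂ) i - (v : Fin 3 → ℂ) i)
        have h2 : (w : Fin 3 → ℂ) i - (v : Fin 3 → ℂ) i + (-(w : Fin 3 → ℂ) i - (v : Fin 3 → ℂ) i)
            = (-2 : ℂ) * (v : Fin 3 → ℂ) i := by ring
        rw [h2, norm_mul, norm_neg, Complex.norm_ofNat] at h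
        linarith

end DoubleCover

section BigComplement

theorem IsBig.of_isCoveringMap {E X : Type*} [TopologicalSpace E] [TopologicalSpace X] {f : E → X}
    (hf : IsCoveringMap f) (e : E) (h : IsBig (FundamentalGroup E e)) :
    IsBig (FundamentalGroup X (f e)) :=
  h.of_injective (FundamentalGroup.map ⟨f, hf.continuous⟩ e) (hf.injective_path_homotopic_map e e)

variable {n : ℕ} {c : Fin n → ℂ}

/-- The finite set of heights removed from the quadric. -/
def heightSet (c : Fin n → ℂ) : Set ℂ := {w | ∃ i, 1 + c i * w ^ 2 = 0}

theorem finite_heightSet (c : Fin n → ℂ) : (heightSet c).Finite := by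
  have h : heightSet c = ⋃ i, {w | 1 + c i * w ^ 2 = 0} := by
    ext w
    simp [heightSet]
  rw [h]
  refine Set.finite_iUnion fun i => ?_
  by_cases hc : c i = 0
  · simp [hc]
  · obtain ⟨t, ht⟩ := IsAlgClosed.exists_eq_mul_self (-(c i)⁻¹)
    refine (Set.toFinite {t, -t}).subset fun w hw => ?_
    have h2 : w ^ 2 = t ^ 2 := by
      have hw : 1 + c i * w ^ 2 = 0 := hw
      rw [sq t, ← ht]
      field_simp
      linear_combination hw
    exact sq_eq_sq_iff_eq_or_eq_neg.1 h2

theorem nontrivial_heightSet {i : Fin n} (hc : c i ≠ 0) : (heightSet c).Nontrivial := by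
  obtain ⟨t, ht⟩ := IsAlgClosed.exists_eq_mul_self (-(c i)⁻¹)
  have ht0 : t ≠ 0 := by
    rintro rfl
    simp [hc] at ht
  have h1 : 1 + c i * t ^ 2 = 0 := by
    rw [sq, ← ht]
    field_simp
    ring
  exact ⟨t, ⟨i, h1⟩, -t, ⟨i, by rwa [neg_sq]⟩, self_ne_neg.2 ht0⟩

/-- Every point of the quadric lies on a line in the quadric transverse to the planes of constant
height. -/
theorem exists_transverse_line {v : Fin 3 → ℂ} (hv : stdQuad v = 1) :
    ∃ a b : ℂ, ∀ m : ℂ, stdQuad (v + m • ![a, b, 1]) = 1 := by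
  rw [stdQuad] at hv
  obtain ⟨a, ha⟩ : ∃ a : ℂ, v 2 * a ^ 2 = 2 * v 0 * a + v 1 := by
    by_cases h : v 2 = 0
    · have h0 : v 0 ≠ 0 := by
        intro h0
        simp [h, h0] at hv
      refine ⟨-v 1 / (2 * v 0), ?_⟩
      rw [h]
      field_simp
      ring
    · refine ⟨(v 0 + 1) / v 2, ?_⟩
      field_simp
      linear_combination -hv
  refine ⟨a, -a ^ 2, fun m => ?_⟩
  simp only [stdQuad, Pi.add_apply, Pi.smul_apply, smul_eq_mul, Matrix.cons_val_zero,
    Matrix.cons_val_one, Matrix.cons_val]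
  linear_combination hv - m * ha

theorem isBig_fundamentalGroup_coverSet {i : Fin n} (hc : c i ≠ 0) (v : coverSet c) :
    IsBig (FundamentalGroup (coverSet c) v) := by
  obtain ⟨a, b, hab⟩ := exists_transverse_line v.2.1
  have h2 : ∀ w : ℂ, ((v : Fin 3 → ℂ) + (w - (v : Fin 3 → ℂ) 2) • ![a, b, 1]) 2 = w := by
    intro w
    simp
  let f : C(↥(heightSet c)ᶜ, coverSet c) :=
    ⟨fun w => ⟨(v : Fin 3 → ℂ) + ((w : ℂ) - (v : Fin 3 → ℂ) 2) • ![a, b, 1], hab _, fun i hi =>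
      w.2 ⟨i, by rwa [h2] at hi⟩⟩, by
        refine Continuous.subtype_mk ?_ _
        fun_prop⟩
  let g : C(coverSet c, ↥(heightSet c)ᶜ) :=
    ⟨fun w => ⟨(w : Fin 3 → ℂ) 2, fun ⟨i, hi⟩ => w.2.2 i hi⟩,
      ((continuous_apply 2).comp continuous_subtype_val).subtype_mk _⟩
  have hfv : f (g v) = v := Subtype.ext (by
    change (v : Fin 3 → ℂ) + ((v : Fin 3 → ℂ) 2 - (v : Fin 3 → ℂ) 2) • ![a, b, 1] = v
    rw [sub_self, zero_smul, add_zero])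
  have h := IsBig.of_continuous_leftInverse f g (fun w => Subtype.ext (h2 w)) (g v)
    (isBig_fundamentalGroup_compl_finite (finite_heightSet c) (nontrivial_heightSet hc) (g v))
  rwa [hfv] at h

end BigComplement

section UnionSimplyConnected

/-- A space covered by two open path-connected sets with path-connected intersection, in each of
which paths are determined up to homotopy by their endpoints, is simply connected. -/
theorem SimplyConnectedSpace.of_isOpen_union {E : Type*} [TopologicalSpace E] {U V : Set E}
    (hU : IsOpen U) (hV : IsOpen V) (hcov : ∀ x, x ∈ U ∨ x ∈ V) (hUc : IsPathConnected U)
    (hVc : IsPathConnected V) (hUVc : IsPathConnected (U ∩ V))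
    (hUh : ∀ (x y : E) (p q : Path x y), (∀ t, p t ∈ U) → (∀ t, q t ∈ U) → p.Homotopic q)
    (hVh : ∀ (x y : E) (p q : Path x y), (∀ t, p t ∈ V) → (∀ t, q t ∈ V) → p.Homotopic q) :
    SimplyConnectedSpace E := by
  obtain ⟨x₀, hx₀, hx₀'⟩ := hUVc
  have hc : ∀ x, ∃ c : Path x₀ x, (x ∈ U → ∀ t, c t ∈ U) ∧ (x ∈ V → ∀ t, c t ∈ V) := by
    intro x
    by_cases hxU : x ∈ U
    · by_cases hxV : x ∈ V
      · obtain ⟨c, hc⟩ := hx₀' ⟨hxU, hxV⟩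
        exact ⟨c, fun _ t => (hc t).1, fun _ t => (hc t).2⟩
      · obtain ⟨c, hc⟩ := hUc.joinedIn x₀ hx₀.1 x hxU
        exact ⟨c, fun _ => hc, fun h => (hxV h).elim⟩
    · obtain ⟨c, hc⟩ := hVc.joinedIn x₀ hx₀.2 x ((hcov x).resolve_left hxU)
      exact ⟨c, fun h => (hxU h).elim, fun _ => hc⟩
  choose c hcU hcV using hc
  have hstep : ∀ {x y : E} (γ : Path x y), (∀ t, γ t ∈ U) ∨ (∀ t, γ t ∈ V) →
      ((c x).trans γ).Homotopic (c y) := by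
    intro x y γ hγ
    have htr : ∀ W : Set E, (∀ t, c x t ∈ W) → (∀ t, γ t ∈ W) → ∀ t, (c x).trans γ t ∈ W := by
      intro W h1 h2 t
      rw [Path.trans_apply]
      split_ifs
      · exact h1 _
      · exact h2 _
    rcases hγ with hγ | hγ
    · exact hUh _ _ _ _ (htr U (hcU x (by simpa using hγ 0)) hγ) (hcU y (by simpa using hγ 1))
    · exact hVh _ _ _ _ (htr V (hcV x (by simpa using hγ 0)) hγ) (hcV y (by simpa using hγ 1))
  have hall : ∀ {x y : E} (γ : Path x y), ((c x).trans γ).Homotopic (c y) := by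
    intro x y γ
    let P (t : unitInterval) : Prop :=
      ((c (γ 0)).trans (γ.subpath 0 t)).Homotopic (c (γ t))
    have hadv : ∀ s t, (∀ W : Set E, (∀ r ∈ Set.uIcc s t, γ r ∈ W) → ∀ r, γ.subpath s t r ∈ W) := by
      intro s t W h r
      obtain ⟨r', hr', h'⟩ := (γ.range_subpath s t).subset ⟨r, rfl⟩
      rw [← h']
      exact h r' hr'
    have hPst : ∀ s t, (∀ r ∈ Set.uIcc s t, γ r ∈ U) ∨ (∀ r ∈ Set.uIcc s t, γ r ∈ V) →
        P s → P t := by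
      intro s t hst hs
      have h1 := hstep (γ.subpath s t) (hst.imp (hadv s t U) (hadv s t V))
      have h2 : ((γ.subpath 0 s).trans (γ.subpath s t)).Homotopic (γ.subpath 0 t) :=
        ⟨Path.Homotopy.subpathTransSubpath γ 0 s t⟩
      refine (Path.Homotopic.hcomp (Path.Homotopic.refl _) h2.symm).trans ?_
      refine Path.Homotopic.trans ?_ ((Path.Homotopic.hcomp hs (Path.Homotopic.refl _)).trans h1)
      exact ⟨(Path.Homotopy.transAssoc _ _ _).symm⟩
    have hloc : ∀ W : Set E, IsOpen W → ∀ s, γ s ∈ W →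
        ∀ᶠ t in nhds s, ∀ r ∈ Set.uIcc s t, γ r ∈ W := by
      intro W hW s hs
      have h1 : γ ⁻¹' W ∈ nhds s := γ.continuous.continuousAt.preimage_mem_nhds (hW.mem_nhds hs)
      have h2 := (Filter.Tendsto.uIcc (tendsto_const_nhds (x := s)) Filter.tendsto_id)
      exact Filter.tendsto_smallSets_iff.1 h2 _ h1
    have hconst : IsLocallyConstant P := by
      rw [IsLocallyConstant.iff_eventually_eq]
      intro s
      have h : ∀ᶠ t in nhds s, (∀ r ∈ Set.uIcc s t, γ r ∈ U) ∨ (∀ r ∈ Set.uIcc s t, γ r ∈ V) := by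
        rcases hcov (γ s) with h | h
        · exact (hloc U hU s h).mono fun _ => Or.inl
        · exact (hloc V hV s h).mono fun _ => Or.inr
      filter_upwards [h] with t ht
      exact propext ⟨hPst t s (by rwa [Set.uIcc_comm]), hPst s t ht⟩
    have hP0 : P 0 := hPst 0 0 (by
      rcases hcov (γ 0) with h | h
      · exact Or.inl (by simpa using h)
      · exact Or.inr (by simpa using h)) (by
      simp only [P, Path.subpath_self]
      exact ⟨Path.Homotopy.transRefl _⟩)
    have hP1 : P 1 := by
      rw [hconst.apply_eq_of_isPreconnected isPreconnected_univ (Set.mem_univ 1) (Set.mem_univ 0)]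
      exact hP0
    have hcast : ∀ {x' y' : E} (hx : x' = x) (hy : y' = y),
        ((c x').trans (γ.cast hx hy)).Homotopic (c y') → ((c x).trans γ).Homotopic (c y) := by
      rintro _ _ rfl rfl h
      exact h
    simp only [P, Path.subpath_zero_one] at hP1
    exact hcast _ _ hP1
  rw [simply_connected_iff_paths_homotopic']
  refine ⟨⟨⟨x₀⟩, fun x y => ⟨(c x).symm.trans (c y)⟩⟩, fun {x y} p q => ?_⟩
  have key : ∀ p : Path x y, p.Homotopic ((c x).symm.trans (c y)) := by
    intro p
    have h1 : ((c x).symm.trans ((c x).trans p)).Homotopic ((c x).symm.trans (c y)) :=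
      Path.Homotopic.hcomp (Path.Homotopic.refl _) (hall p)
    refine Path.Homotopic.trans ?_ h1
    refine Path.Homotopic.trans ?_ ⟨Path.Homotopy.transAssoc _ _ _⟩
    have h2 : ((c x).symm.trans (c x)).Homotopic (Path.refl x) :=
      ⟨(Path.Homotopy.reflSymmTrans _).symm⟩
    refine Path.Homotopic.trans ?_ (Path.Homotopic.hcomp h2.symm (Path.Homotopic.refl p))
    exact ⟨(Path.Homotopy.reflTrans _).symm⟩
  exact (key p).trans (key q).symm

end UnionSimplyConnected

section Quadric

theorem Path.Homotopic.of_continuousOn_retract {E F : Type*} [TopologicalSpace E]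
    [TopologicalSpace F] [SimplyConnectedSpace F] {W : Set E} {a : E → F} (ha : ContinuousOn a W)
    {b : F → E} (hb : Continuous b) (hba : ∀ x ∈ W, b (a x) = x) {x y : E} (p q : Path x y)
    (hp : ∀ t, p t ∈ W) (hq : ∀ t, q t ∈ W) : p.Homotopic q := by
  let p' : Path (a x) (a y) := ⟨⟨fun t => a (p t), ha.comp_continuous p.continuous hp⟩,
    by simp, by simp⟩
  let q' : Path (a x) (a y) := ⟨⟨fun t => a (q t), ha.comp_continuous q.continuous hq⟩,
    by simp, by simp⟩
  have h : p'.Homotopic q' := SimplyConnectedSpace.paths_homotopic p' q'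
  have h2 := ContinuousMap.HomotopicRel.comp_continuousMap h ⟨b, hb⟩
  have hp2 : (ContinuousMap.mk b hb).comp p'.toContinuousMap = p.toContinuousMap :=
    ContinuousMap.ext fun t => hba _ (hp t)
  have hq2 : (ContinuousMap.mk b hb).comp q'.toContinuousMap = q.toContinuousMap :=
    ContinuousMap.ext fun t => hba _ (hq t)
  rwa [hp2, hq2] at h2

/-- The affine quadric `x² + yz = 1`. -/
def quadric : Set (Fin 3 → ℂ) := {v | stdQuad v = 1}

/-- The complement of the line `x = -1, z = 0` in the quadric. -/
def quadricChart : Set quadric := {v | 1 + (v : Fin 3 → ℂ) 0 ≠ 0 ∨ (v : Fin 3 → ℂ) 2 ≠ 0}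

/-- The parametrization of a chart of the quadric. -/
def quadricParam (p : ℂ × ℂ) : quadric :=
  ⟨![1 - p.1 * p.2, p.1 * (2 - p.1 * p.2), p.2], by
    simp only [quadric, Set.mem_ofPred_eq, stdQuad, Matrix.cons_val_zero, Matrix.cons_val_one,
      Matrix.cons_val]
    ring⟩

/-- The inverse of the parametrization of a chart of the quadric. -/
def quadricCoord (v : quadric) : ℂ × ℂ :=
  ((starRingEnd ℂ (1 + (v : Fin 3 → ℂ) 0) * (v : Fin 3 → ℂ) 1 +
      starRingEnd ℂ ((v : Fin 3 → ℂ) 2) * (1 - (v : Fin 3 → ℂ) 0)) /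
    (starRingEnd ℂ (1 + (v : Fin 3 → ℂ) 0) * (1 + (v : Fin 3 → ℂ) 0) +
      starRingEnd ℂ ((v : Fin 3 → ℂ) 2) * (v : Fin 3 → ℂ) 2), (v : Fin 3 → ℂ) 2)

/-- The involution of the quadric exchanging its two charts. -/
def quadricInvol (v : quadric) : quadric :=
  ⟨![-(v : Fin 3 → ℂ) 0, (v : Fin 3 → ℂ) 2, (v : Fin 3 → ℂ) 1], by
    have h : stdQuad v = 1 := v.2
    simp only [quadric, Set.mem_ofPred_eq, stdQuad, Matrix.cons_val_zero, Matrix.cons_val_one,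
      Matrix.cons_val] at h ⊢
    linear_combination h⟩

theorem continuous_quadric_apply (i : Fin 3) : Continuous fun v : quadric => (v : Fin 3 → ℂ) i :=
  (continuous_apply i).comp continuous_subtype_val

theorem continuous_quadricParam : Continuous quadricParam := by
  refine Continuous.subtype_mk ?_ _
  fun_prop

theorem continuous_quadricInvol : Continuous quadricInvol := by
  refine Continuous.subtype_mk ?_ _
  have h := continuous_quadric_apply
  exact continuous_pi (Fin.forall_fin_succ.2 ⟨(h 0).neg, Fin.forall_fin_two.2 ⟨h 2, h 1⟩⟩)

theorem quadricInvol_quadricInvol (v : quadric) : quadricInvol (quadricInvol v) = v := by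
  refine Subtype.ext (funext fun i => ?_)
  fin_cases i <;> simp [quadricInvol]

theorem quadric_denom_ne_zero {v : quadric} (hv : v ∈ quadricChart) :
    starRingEnd ℂ (1 + (v : Fin 3 → ℂ) 0) * (1 + (v : Fin 3 → ℂ) 0) +
      starRingEnd ℂ ((v : Fin 3 → ℂ) 2) * (v : Fin 3 → ℂ) 2 ≠ 0 := by
  rw [← Complex.normSq_eq_conj_mul_self, ← Complex.normSq_eq_conj_mul_self, ← Complex.ofReal_add,
    Complex.ofReal_ne_zero]
  rcases hv with h | h
  · have := Complex.normSq_pos.2 h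
    have := Complex.normSq_nonneg ((v : Fin 3 → ℂ) 2)
    linarith
  · have := Complex.normSq_pos.2 h
    have := Complex.normSq_nonneg (1 + (v : Fin 3 → ℂ) 0)
    linarith

theorem continuousOn_quadricCoord : ContinuousOn quadricCoord quadricChart := by
  have h := continuous_quadric_apply
  have hs := Complex.continuous_conj
  refine ContinuousOn.prodMk (ContinuousOn.div ?_ ?_ fun v hv => quadric_denom_ne_zero hv)
    (h 2).continuousOn
  · exact (((hs.comp (continuous_const.add (h 0))).mul (h 1)).add
      ((hs.comp (h 2)).mul (continuous_const.sub (h 0)))).continuousOn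
  · exact (((hs.comp (continuous_const.add (h 0))).mul (continuous_const.add (h 0))).add
      ((hs.comp (h 2)).mul (h 2))).continuousOn

theorem quadricParam_quadricCoord {v : quadric} (hv : v ∈ quadricChart) :
    quadricParam (quadricCoord v) = v := by
  have h : (v : Fin 3 → ℂ) 0 ^ 2 + (v : Fin 3 → ℂ) 1 * (v : Fin 3 → ℂ) 2 = 1 := v.2
  have hd := quadric_denom_ne_zero hv
  have hr := div_mul_cancel₀ (starRingEnd ℂ (1 + (v : Fin 3 → ℂ) 0) * (v : Fin 3 → ℂ) 1 +
    starRingEnd ℂ ((v : Fin 3 → ℂ) 2) * (1 - (v : Fin 3 → ℂ) 0)) hd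
  have h1 : 1 - (quadricCoord v).1 * (v : Fin 3 → ℂ) 2 = (v : Fin 3 → ℂ) 0 := by
    rw [quadricCoord]
    refine mul_right_cancel₀ hd ?_
    linear_combination -(v : Fin 3 → ℂ) 2 * hr - starRingEnd ℂ (1 + (v : Fin 3 → ℂ) 0) * h
  have h2 : (quadricCoord v).1 * (2 - (quadricCoord v).1 * (v : Fin 3 → ℂ) 2) =
      (v : Fin 3 → ℂ) 1 := by
    have h3 : 2 - (quadricCoord v).1 * (v : Fin 3 → ℂ) 2 = 1 + (v : Fin 3 → ℂ) 0 := by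
      linear_combination h1
    rw [h3, quadricCoord]
    refine mul_right_cancel₀ hd ?_
    linear_combination (1 + (v : Fin 3 → ℂ) 0) * hr - starRingEnd ℂ ((v : Fin 3 → ℂ) 2) * h
  refine Subtype.ext (funext fun i => ?_)
  fin_cases i
  · exact h1
  · exact h2
  · rfl

theorem quadricParam_mem (p : ℂ × ℂ) : quadricParam p ∈ quadricChart := by
  by_cases h : p.2 = 0
  · left
    simp only [quadricParam, Matrix.cons_val_zero, h]
    norm_num
  · exact Or.inr h

theorem quadricInvol_quadricParam_mem {p : ℂ × ℂ} :
    quadricInvol (quadricParam p) ∈ quadricChart ↔ p.1 ≠ 0 := by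
  have h : quadricInvol (quadricParam p) ∈ quadricChart ↔
      1 + -(1 - p.1 * p.2) ≠ 0 ∨ p.1 * (2 - p.1 * p.2) ≠ 0 := Iff.rfl
  rw [h]
  constructor
  · rintro h h0
    simp [h0] at h
  · intro h0
    by_cases h2 : p.2 = 0
    · right
      simp [h2, h0]
    · left
      simp [h2, h0]

instance simplyConnectedSpace_quadric : SimplyConnectedSpace quadric := by
  have hcont := continuous_quadric_apply
  have hopen : IsOpen quadricChart :=
    (isOpen_ne_fun (continuous_const.add (hcont 0)) continuous_const).union
      (isOpen_ne_fun (hcont 2) continuous_const)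
  have hrange : quadricParam '' Set.univ = quadricChart := by
    refine Set.Subset.antisymm ?_ fun v hv => ⟨_, trivial, quadricParam_quadricCoord hv⟩
    rintro _ ⟨p, -, rfl⟩
    exact quadricParam_mem p
  have hpc : IsPathConnected quadricChart := by
    rw [← hrange]
    exact isPathConnected_univ.image continuous_quadricParam
  have hinv : quadricInvol '' quadricChart = quadricInvol ⁻¹' quadricChart :=
    congrFun (Function.Involutive.image_eq_preimage_symm quadricInvol_quadricInvol) _
  refine SimplyConnectedSpace.of_isOpen_union (U := quadricChart)
    (V := quadricInvol ⁻¹' quadricChart) hopen (hopen.preimage continuous_quadricInvol)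
    (fun v => ?_) hpc ?_ ?_ ?_ ?_
  · by_cases h : 1 + (v : Fin 3 → ℂ) 0 = 0
    · refine Or.inr (Or.inl ?_)
      change 1 + -(v : Fin 3 → ℂ) 0 ≠ 0
      intro h'
      have : (2 : ℂ) = 0 := by linear_combination h + h'
      norm_num at this
    · exact Or.inl (Or.inl h)
  · rw [← hinv]
    exact hpc.image continuous_quadricInvol
  · have h : quadricChart ∩ quadricInvol ⁻¹' quadricChart =
        quadricParam '' ({0}ᶜ ×ˢ Set.univ) := by
      ext v
      constructor
      · rintro ⟨h1, h2⟩
        rw [Set.mem_preimage, ← quadricParam_quadricCoord h1, quadricInvol_quadricParam_mem] at h2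
        exact ⟨_, ⟨h2, trivial⟩, quadricParam_quadricCoord h1⟩
      · rintro ⟨p, ⟨hp, -⟩, rfl⟩
        exact ⟨quadricParam_mem p, quadricInvol_quadricParam_mem.2 hp⟩
    rw [h]
    have h0 : IsPathConnected ({0}ᶜ : Set ℂ) :=
      isPathConnected_compl_singleton_of_one_lt_rank (by
        rw [Complex.rank_real_complex]; norm_num) 0
    exact (h0.prod isPathConnected_univ).image continuous_quadricParam
  · exact fun x y p q => Path.Homotopic.of_continuousOn_retract continuousOn_quadricCoord
      continuous_quadricParam (fun v hv => quadricParam_quadricCoord hv) p q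
  · refine fun x y p q => Path.Homotopic.of_continuousOn_retract
      (W := quadricInvol ⁻¹' quadricChart) (a := quadricCoord ∘ quadricInvol)
      (b := quadricInvol ∘ quadricParam)
      (continuousOn_quadricCoord.comp continuous_quadricInvol.continuousOn fun v hv => hv)
      (continuous_quadricInvol.comp continuous_quadricParam) (fun v hv => ?_) p q
    simp only [Function.comp_apply]
    rw [quadricParam_quadricCoord hv, quadricInvol_quadricInvol]

end Quadric

/-- **Corollary.** For the arrangement `ℬₙ`, the fundamental group of the complement is
abelian for `n = 1` and big for `n ≥ 2`. -/
theorem fundamental_group_Bn_abelian_or_big (n : ℕ) (hn : 1 ≤ n) (Q : Fin n → Set P2)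
    (hconic : ∀ i, IsSmoothConic (Q i))
    (hdist : ∀ i j : Fin n, i ≠ j → Q i ≠ Q j)
    (p : P2)
    (hint : ∀ i j : Fin n, i ≠ j → Q i ∩ Q j = {p})
    (x : ↥(⋃ i, Q i)ᶜ) :
    (n = 1 → ∀ a b : FundamentalGroup (↥(⋃ i, Q i)ᶜ) x, a * b = b * a) ∧
    (2 ≤ n → IsBig (FundamentalGroup (↥(⋃ i, Q i)ᶜ) x)) := by
  obtain ⟨L, i₀, c, hc0, hc, hQ⟩ := exists_arrangement_normalForm hn Q hconic p hint
  obtain ⟨v, rfl⟩ := coverMap_surjective hQ ⟨i₀, hc0⟩ x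
  have hq := coverMap_isQuotientCoveringMap hQ ⟨i₀, hc0⟩
  constructor
  · rintro rfl a b
    have hcover : coverSet c = quadric := by
      ext w
      refine ⟨fun h => h.1, fun h => ⟨h, fun i => ?_⟩⟩
      rw [Subsingleton.elim i i₀, hc0]
      simp
    have : SimplyConnectedSpace (coverSet c) := by
      rw [hcover]
      infer_instance
    refine hq.fundamentalGroupToMulOpposite_injective ⟨v, rfl⟩ ?_
    rw [map_mul, map_mul, mul_comm]
  · intro h2
    have : Nontrivial (Fin n) := Fin.nontrivial_iff_two_le.2 h2
    obtain ⟨i, hi⟩ := exists_ne i₀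
    exact IsBig.of_isCoveringMap hq.isCoveringMap v (isBig_fundamentalGroup_coverSet (hc i hi) v)
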